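/- Let p ≥ 1, s₀ an integer with 1 ≤ s₀ ≤ p, k₀ ≥ 0, and let x ∈ ℝ^p be such that ‖x_{J^c}‖₁ ≤ k₀·‖x_J‖₁ for some J ⊆ {1,…,p} with |J| = s₀. Let T₀ be a set of indices of the s₀ largest coordinates of x in absolute value. Then ‖x‖₂ ≤ √(1 + k₀)·‖x_{T₀}‖₂. -/

import Mathlib

open Finset Matrix Real
open scoped BigOperators Classical

noncomputable section

namespace ThreshLasso

/-- ℓ₂ norm of a finite real vector. -/
def l2 {m : ℕ} (v : Fin m → ℝ) : ℝ := Real.sqrt (∑ i, (v i) ^ 2)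

/-- ℓ₁ norm of a finite real vector. -/
def l1 {m : ℕ} (v : Fin m → ℝ) : ℝ := ∑ i, |v i|

/-- Restriction of a vector to a set of coordinates (zero outside). -/
def restr {p : ℕ} (v : Fin p → ℝ) (T : Finset (Fin p)) : Fin p → ℝ :=
  fun j => if j ∈ T then v j else 0

/-- Support of a vector, as a `Finset`. -/
def supp {p : ℕ} (v : Fin p → ℝ) : Finset (Fin p) :=
  Finset.univ.filter fun j => v j ≠ 0

/-- `L` is the minimal `m`-sparse eigenvalue `Λ_min(m)` of `X`:
the least value of `‖Xv‖₂²/(n‖v‖₂²)` over nonzero `v` with at most `m`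
nonzero coordinates. -/
def IsLambdaMin {n p : ℕ} (X : Matrix (Fin n) (Fin p) ℝ) (m : ℕ) (L : ℝ) : Prop :=
  IsLeast {r : ℝ | ∃ v : Fin p → ℝ, v ≠ 0 ∧ (supp v).card ≤ m ∧
    r = (l2 (X.mulVec v)) ^ 2 / (n * (l2 v) ^ 2)} L

/-- `L` is the maximal `m`-sparse eigenvalue `Λ_max(m)` of `X`
(with the convention `Λ_max(0) = 0`, implemented by inserting `0` in the set,
which does not change the maximum when `m ≥ 1`). -/
def IsLambdaMax {n p : ℕ} (X : Matrix (Fin n) (Fin p) ℝ) (m : ℕ) (L : ℝ) : Prop :=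
  IsGreatest (insert (0 : ℝ) {r : ℝ | ∃ v : Fin p → ℝ, v ≠ 0 ∧ (supp v).card ≤ m ∧
    r = (l2 (X.mulVec v)) ^ 2 / (n * (l2 v) ^ 2)}) L

/-- `θ` is the restricted orthogonality constant `θ_{m,m'}` of `X`: the smallest
nonnegative `t` such that `|⟨Xu, Xu'⟩|/n ≤ t‖u‖₂‖u'‖₂` for all `u, u'` supported
on disjoint sets of cardinality at most `m`, `m'` respectively. -/
def IsTheta {n p : ℕ} (X : Matrix (Fin n) (Fin p) ℝ) (m m' : ℕ) (θ : ℝ) : Prop :=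
  IsLeast {t : ℝ | 0 ≤ t ∧ ∀ (u u' : Fin p → ℝ) (T T' : Finset (Fin p)),
    Disjoint T T' → T.card ≤ m → T'.card ≤ m' →
    (∀ j, j ∉ T → u j = 0) → (∀ j, j ∉ T' → u' j = 0) →
    |∑ i, (X.mulVec u i) * (X.mulVec u' i)| / n ≤ t * (l2 u * l2 u')} θ

/-- Restricted eigenvalue condition `RE(s₀, k₀, X)` with constant `K`. -/
def RECond {n p : ℕ} (X : Matrix (Fin n) (Fin p) ℝ) (s₀ : ℕ) (k₀ K : ℝ) : Prop :=
  0 < K ∧ ∀ (v : Fin p → ℝ) (J : Finset (Fin p)), J.card ≤ s₀ →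
    l1 (restr v Jᶜ) ≤ k₀ * l1 (restr v J) →
    l2 (restr v J) / K ≤ l2 (X.mulVec v) / Real.sqrt n

/-- `s₀` is the essential sparsity of `β`: the smallest nonnegative integer `m`
with `∑ᵢ min(βᵢ², λ²σ²) ≤ m λ²σ²`. -/
def EssSparsity {p : ℕ} (β : Fin p → ℝ) (lam σ : ℝ) (s₀ : ℕ) : Prop :=
  IsLeast {m : ℕ | ∑ i, min ((β i) ^ 2) (lam ^ 2 * σ ^ 2) ≤ (m : ℝ) * (lam ^ 2 * σ ^ 2)} s₀

/-- `T₀` is a set of indices of the `s₀` largest coordinates of `β` in absolute value. -/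
def TopSet {p : ℕ} (β : Fin p → ℝ) (s₀ : ℕ) (T₀ : Finset (Fin p)) : Prop :=
  T₀.card = s₀ ∧ ∀ i ∈ T₀, ∀ j, j ∉ T₀ → |β j| ≤ |β i|

/-- `T₁` is a set of indices of the `s₀` largest coordinates of `h` in absolute
value outside `T₀`. -/
def TopSetOutside {p : ℕ} (h : Fin p → ℝ) (s₀ : ℕ) (T₀ T₁ : Finset (Fin p)) : Prop :=
  T₁.card = s₀ ∧ Disjoint T₀ T₁ ∧
    ∀ i ∈ T₁, ∀ j, j ∉ T₀ → j ∉ T₁ → |h j| ≤ |h i|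

/-- `b` is a Lasso minimizer with penalty `lamn` for data `(X, Y)`. -/
def IsLassoSol {n p : ℕ} (X : Matrix (Fin n) (Fin p) ℝ) (Y : Fin n → ℝ)
    (lamn : ℝ) (b : Fin p → ℝ) : Prop :=
  ∀ b' : Fin p → ℝ,
    1 / (2 * n) * (l2 (Y - X.mulVec b)) ^ 2 + lamn * l1 b ≤
    1 / (2 * n) * (l2 (Y - X.mulVec b')) ^ 2 + lamn * l1 b'

/-- Submatrix of the columns of `X` indexed by `I`. -/
def colSub {n p : ℕ} (X : Matrix (Fin n) (Fin p) ℝ) (I : Finset (Fin p)) :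
    Matrix (Fin n) {j // j ∈ I} ℝ :=
  Matrix.of fun i j => X i j.1

/-- The Gram matrix `X_Iᵀ X_I` is invertible. -/
def GramInvertible {n p : ℕ} (X : Matrix (Fin n) (Fin p) ℝ) (I : Finset (Fin p)) : Prop :=
  IsUnit ((colSub X I)ᵀ * colSub X I).det

/-- The OLS refit of `Y` on the columns of `X` indexed by `I`:
`(X_Iᵀ X_I)⁻¹ X_Iᵀ Y` on `I`, and `0` off `I`. -/
def olsRefit {n p : ℕ} (X : Matrix (Fin n) (Fin p) ℝ) (Y : Fin n → ℝ)
    (I : Finset (Fin p)) : Fin p → ℝ :=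
  fun j => if h : j ∈ I then
    (((colSub X I)ᵀ * colSub X I)⁻¹).mulVec ((colSub X I)ᵀ.mulVec Y) ⟨j, h⟩
  else 0


theorem l1_restr {p : ℕ} (v : Fin p → ℝ) (T : Finset (Fin p)) :
    l1 (restr v T) = ∑ i ∈ T, |v i| := by
  simp [l1, restr, apply_ite abs, Finset.sum_ite_mem]

theorem l2_restr {p : ℕ} (v : Fin p → ℝ) (T : Finset (Fin p)) :
    l2 (restr v T) = Real.sqrt (∑ i ∈ T, v i ^ 2) := by
  simp [l2, restr, ite_pow, Finset.sum_ite_mem]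

/-- A nonempty top set has a threshold: it separates the coordinates inside from those outside. -/
theorem TopSet.exists_threshold {p s : ℕ} {v : Fin p → ℝ} {T : Finset (Fin p)}
    (hT : TopSet v s T) (hs : 1 ≤ s) :
    ∃ m, 0 ≤ m ∧ (∀ i ∈ T, m ≤ |v i|) ∧ ∀ j ∉ T, |v j| ≤ m := by
  have hne : T.Nonempty := Finset.card_pos.mp (by have := hT.1; omega)
  obtain ⟨a, ha, hmin⟩ := T.exists_min_image (fun i => |v i|) hne
  exact ⟨|v a|, abs_nonneg _, hmin, hT.2 a ha⟩

/-- Among sets of a given size, one lying above a threshold and whose complement lies below it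
maximizes the sum. -/
theorem sum_le_sum_of_threshold {ι : Type*} {f : ι → ℝ} {m : ℝ} {S T : Finset ι}
    (hcard : S.card = T.card) (hin : ∀ i ∈ T, m ≤ f i) (hout : ∀ j ∉ T, f j ≤ m) :
    ∑ i ∈ S, f i ≤ ∑ i ∈ T, f i := by
  have hdiff : (S \ T).card = (T \ S).card := Finset.card_sdiff_comm hcard
  have hS : ∑ i ∈ S \ T, f i ≤ (S \ T).card • m :=
    Finset.sum_le_card_nsmul _ _ _ fun i hi => hout i (Finset.mem_sdiff.mp hi).2
  have hT : (T \ S).card • m ≤ ∑ i ∈ T \ S, f i :=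
    Finset.card_nsmul_le_sum _ _ _ fun i hi => hin i (Finset.mem_sdiff.mp hi).1
  rw [← Finset.sum_inter_add_sum_sdiff S T f, ← Finset.sum_inter_add_sum_sdiff T S f,
    Finset.inter_comm T S]
  rw [hdiff] at hS
  linarith

/-- ℓ₂ bound on a vector in the cone `C(s₀, k₀)`. -/
theorem statement_6
    (p s₀ : ℕ) (hp : 1 ≤ p) (hs₀ : 1 ≤ s₀) (hs₀p : s₀ ≤ p)
    (k₀ : ℝ) (hk₀ : 0 ≤ k₀)
    (x : Fin p → ℝ) (J : Finset (Fin p)) (hJ : J.card = s₀)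
    (hcone : l1 (restr x Jᶜ) ≤ k₀ * l1 (restr x J))
    (T₀ : Finset (Fin p)) (hT₀ : TopSet x s₀ T₀) :
    l2 x ≤ Real.sqrt (1 + k₀) * l2 (restr x T₀) := by
  obtain ⟨m, hm, hin, hout⟩ := hT₀.exists_threshold hs₀
  rw [l1_restr, l1_restr] at hcone
  have htop : ∑ i ∈ J, |x i| ≤ ∑ i ∈ T₀, |x i| :=
    sum_le_sum_of_threshold (hJ.trans hT₀.1.symm) hin hout
  have htail : ∑ i ∈ T₀ᶜ, |x i| ≤ k₀ * ∑ i ∈ T₀, |x i| := by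
    have hsumJ := Finset.sum_add_sum_compl J fun i => |x i|
    have hsumT := Finset.sum_add_sum_compl T₀ fun i => |x i|
    have := mul_le_mul_of_nonneg_left htop hk₀
    linarith
  have hsq_out : ∑ i ∈ T₀ᶜ, x i ^ 2 ≤ m * ∑ i ∈ T₀ᶜ, |x i| := by
    rw [Finset.mul_sum]
    refine Finset.sum_le_sum fun i hi => ?_
    rw [← sq_abs, sq]
    exact mul_le_mul_of_nonneg_right (hout i (Finset.mem_compl.mp hi)) (abs_nonneg _)
  have hsq_in : m * ∑ i ∈ T₀, |x i| ≤ ∑ i ∈ T₀, x i ^ 2 := by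
    rw [Finset.mul_sum]
    refine Finset.sum_le_sum fun i hi => ?_
    rw [← sq_abs (x i), sq]
    exact mul_le_mul_of_nonneg_right (hin i hi) (abs_nonneg _)
  rw [l2_restr, l2, ← Real.sqrt_mul (by linarith)]
  refine Real.sqrt_le_sqrt ?_
  rw [← Finset.sum_add_sum_compl T₀ fun i => x i ^ 2]
  have h₁ := mul_le_mul_of_nonneg_left htail hm
  have h₂ := mul_le_mul_of_nonneg_left hsq_in hk₀
  linarith

end ThreshLasso
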